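/- Let p be a prime, let n, k, l be positive integers with l | k and k/l odd, and set d = gcd(n,k), e = gcd(n,l), L = lcm(d,l). Suppose n/d is even. Then {x ∈ 𝔽_{p^n} : S_l^k(x) = 0} equals {x − x^{p^d} : x ∈ 𝔽_{p^{2d}}} if p divides k/L, and equals {(x + x^{p^e}) − (x + x^{p^e})^{p^d} : x ∈ 𝔽_{p^{2d}}} otherwise. Consequently its cardinality is p^d if p divides k/L, and p^{d−e} otherwise. -/

import Mathlib

open Finset

/-- `Tmap p u v x = Σ_{i=0}^{v/u - 1} x^{p^{u i}}` on the algebraic closure of `𝔽_p`. -/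
noncomputable def Tmap (p : ℕ) [Fact p.Prime] (u v : ℕ) (x : AlgebraicClosure (ZMod p)) :
    AlgebraicClosure (ZMod p) :=
  ∑ i ∈ Finset.range (v / u), x ^ p ^ (u * i)

/-- `Smap p u v x = Σ_{i=0}^{v/u - 1} (-1)^i x^{p^{u i}}` on the algebraic closure of `𝔽_p`. -/
noncomputable def Smap (p : ℕ) [Fact p.Prime] (u v : ℕ) (x : AlgebraicClosure (ZMod p)) :
    AlgebraicClosure (ZMod p) :=
  ∑ i ∈ Finset.range (v / u), (-1 : AlgebraicClosure (ZMod p)) ^ i * x ^ p ^ (u * i)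

/-- `Ffield p m` is the subfield `𝔽_{p^m} = {x : x^{p^m} = x}` of the algebraic closure of `𝔽_p`. -/
def Ffield (p : ℕ) [Fact p.Prime] (m : ℕ) : Set (AlgebraicClosure (ZMod p)) :=
  {x | x ^ p ^ m = x}

/-- The Frobenius endomorphism of the additive group of the algebraic closure of `𝔽_p`. -/
noncomputable def frobEnd (p : ℕ) [Fact p.Prime] : Module.End ℤ (AlgebraicClosure (ZMod p)) :=
  (frobenius (AlgebraicClosure (ZMod p)) p).toAddMonoidHom.toIntLinearMap

lemma frobEnd_pow_apply (p : ℕ) [Fact p.Prime] (m : ℕ) (x : AlgebraicClosure (ZMod p)) :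
    (frobEnd p ^ m) x = x ^ p ^ m := by
  induction m generalizing x with
  | zero => simp
  | succ m ih =>
    rw [_root_.pow_succ, Module.End.mul_apply, ih]
    change (x ^ p) ^ p ^ m = _
    rw [← pow_mul, ← pow_succ']

lemma Smap_eq_sum (p : ℕ) [Fact p.Prime] (u v : ℕ) (x : AlgebraicClosure (ZMod p)) :
    Smap p u v x = ∑ i ∈ range (v / u), ((-frobEnd p ^ u) ^ i) x := by
  refine sum_congr rfl fun i _ => ?_
  rw [neg_pow (frobEnd p ^ u), ← pow_mul]
  rcases Nat.even_or_odd i with h | h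
  · simp [h.neg_one_pow, frobEnd_pow_apply]
  · simp [h.neg_one_pow, frobEnd_pow_apply]

lemma pow_mul_apply_of_fixed {A : Type*} [AddCommGroup A] (H : Module.End ℤ A) {x : A} {m : ℕ}
    (h : (H ^ m) x = x) (q : ℕ) : (H ^ (m * q)) x = x := by
  induction q with
  | zero => simp
  | succ q ih => rw [Nat.mul_succ, pow_add, Module.End.mul_apply, h, ih]

lemma pow_mod_apply_of_fixed {A : Type*} [AddCommGroup A] (H : Module.End ℤ A) {x : A} {m : ℕ}
    (h : (H ^ m) x = x) (j : ℕ) : (H ^ (j % m)) x = (H ^ j) x := by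
  conv_rhs =>
    rw [← Nat.mod_add_div j m, pow_add, Module.End.mul_apply, pow_mul_apply_of_fixed H h]

lemma sum_range_mul_pow_apply_of_fixed {A : Type*} [AddCommGroup A] (H : Module.End ℤ A) {x : A}
    {m : ℕ} (h : (H ^ m) x = x) (q : ℕ) :
    ∑ i ∈ range (m * q), (H ^ i) x = q • ∑ i ∈ range m, (H ^ i) x := by
  induction q with
  | zero => simp
  | succ q ih =>
    rw [Nat.mul_succ, sum_range_add, ih, succ_nsmul]
    congr 1
    refine sum_congr rfl fun i _ => ?_
    rw [add_comm, pow_add, Module.End.mul_apply, pow_mul_apply_of_fixed H h]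

lemma sum_pow_pow_apply_of_coprime {A : Type*} [AddCommGroup A] (G : Module.End ℤ A) {x : A}
    {a m : ℕ} (hm : 0 < m) (h : (G ^ m) x = x) (ham : a.Coprime m) :
    ∑ i ∈ range m, ((G ^ a) ^ i) x = ∑ i ∈ range m, (G ^ i) x := by
  have hmaps : Set.MapsTo (fun i => a * i % m) (range m : Set ℕ) (range m : Set ℕ) :=
    fun i _ => by simpa using Nat.mod_lt _ hm
  have hinj : Set.InjOn (fun i => a * i % m) (range m : Set ℕ) := by
    intro i hi j hj hij
    have hmod : i ≡ j [MOD m] := Nat.ModEq.cancel_left_of_coprime ham.symm hij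
    exact hmod.eq_of_lt_of_lt (by simpa using hi) (by simpa using hj)
  refine sum_nbij (fun i => a * i % m) hmaps hinj
    (surjOn_of_injOn_of_card_le _ hmaps hinj le_rfl) fun i _ => ?_
  rw [pow_mod_apply_of_fixed G h, pow_mul]

/-- The linearized polynomial `Σ_{i=0}^m c_i X^{p^{r i}}`. -/
noncomputable def linearizedPoly {R : Type*} [Semiring R] (p r m : ℕ) (c : ℕ → R) :
    Polynomial R :=
  ∑ i ∈ range (m + 1), Polynomial.C (c i) * Polynomial.X ^ p ^ (r * i)

lemma natDegree_linearizedPoly {R : Type*} [Semiring R] {p r m : ℕ} (hp : 1 < p) (hr : 0 < r)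
    {c : ℕ → R} (hc : c m ≠ 0) : (linearizedPoly p r m c).natDegree = p ^ (r * m) := by
  apply Polynomial.natDegree_eq_of_le_of_coeff_ne_zero
  · refine Polynomial.natDegree_sum_le_of_forall_le _ _ fun i hi => ?_
    refine (Polynomial.natDegree_C_mul_X_pow_le _ _).trans ?_
    exact Nat.pow_le_pow_right hp.le (Nat.mul_le_mul_left _ (Nat.lt_succ_iff.1 (mem_range.1 hi)))
  · rw [linearizedPoly, Polynomial.finsetSum_coeff, sum_eq_single m]
    · simpa using hc
    · intro i _ hi
      rw [Polynomial.coeff_C_mul_X_pow, if_neg]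
      intro h
      exact hi (Nat.eq_of_mul_eq_mul_left hr (Nat.pow_right_injective hp h)).symm
    · simp

lemma eval_linearizedPoly {R : Type*} [CommSemiring R] (p r m : ℕ) (c : ℕ → R) (x : R) :
    (linearizedPoly p r m c).eval x = ∑ i ∈ range (m + 1), c i * x ^ p ^ (r * i) := by
  simp [linearizedPoly, Polynomial.eval_finsetSum]

lemma derivative_linearizedPoly {R : Type*} [CommRing R] (p r m : ℕ) [CharP R p] (hr : 0 < r)
    (c : ℕ → R) : (linearizedPoly p r m c).derivative = Polynomial.C (c 0) := by
  rw [linearizedPoly, Polynomial.derivative_sum, sum_range_succ', sum_eq_zero]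
  · simp
  · intro i _
    simp [Polynomial.derivative_X_pow, hr.ne']

lemma ncard_linearized_roots {K : Type*} [Field K] [IsAlgClosed K] {p r m : ℕ} [CharP K p]
    (hp : 1 < p) (hr : 0 < r) {c : ℕ → K} (h0 : c 0 ≠ 0) (hm : c m ≠ 0) :
    {x : K | ∑ i ∈ range (m + 1), c i * x ^ p ^ (r * i) = 0}.ncard = p ^ (r * m) := by
  have hdeg := natDegree_linearizedPoly hp hr hm
  have hne : linearizedPoly p r m c ≠ 0 := by
    intro h
    rw [h, Polynomial.natDegree_zero] at hdeg
    exact (Nat.pow_pos (by omega : 0 < p)).ne hdeg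
  have hsep : (linearizedPoly p r m c).Separable := by
    rw [Polynomial.separable_def, derivative_linearizedPoly p r m hr]
    exact (isCoprime_zero_left.2 (Polynomial.isUnit_C.2 h0.isUnit)).of_isCoprime_of_dvd_left
      (dvd_zero _)
  have hset : {x : K | ∑ i ∈ range (m + 1), c i * x ^ p ^ (r * i) = 0} =
      (linearizedPoly p r m c).rootSet K := by
    ext x
    rw [Polynomial.mem_rootSet_of_ne hne, Polynomial.coe_aeval_eq_eval, eval_linearizedPoly]
    rfl
  rw [hset, ← Nat.card_coe_set_eq, Nat.card_eq_fintype_card,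
    Polynomial.card_rootSet_eq_natDegree hsep (IsAlgClosed.splits _), hdeg]

lemma exists_add_mul_pow_eq {K : Type*} [Field K] [IsAlgClosed K] {p r : ℕ} (hp : 1 < p)
    (hr : 0 < r) {b : K} (hb : b ≠ 0) (y : K) : ∃ x : K, x + b * x ^ p ^ r = y := by
  have hlt : 1 < p ^ r := Nat.one_lt_pow hr.ne' hp
  have hdeg : (Polynomial.C b * Polynomial.X ^ p ^ r + Polynomial.X -
      Polynomial.C y).degree ≠ 0 := by
    have : (Polynomial.C b * Polynomial.X ^ p ^ r + Polynomial.X - Polynomial.C y).natDegree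
        = p ^ r := by
      compute_degree!
      · rw [if_neg hlt.ne, if_neg fun h => (zero_lt_one.trans hp).ne' h.1]
        simpa using hb
      · exact hlt.le
    intro h
    have h0 := Polynomial.natDegree_eq_zero_iff_degree_le_zero.2 h.le
    omega
  obtain ⟨x, hx⟩ := IsAlgClosed.exists_root _ hdeg
  refine ⟨x, ?_⟩
  simp only [Polynomial.IsRoot, Polynomial.eval_sub, Polynomial.eval_add, Polynomial.eval_mul,
    Polynomial.eval_C, Polynomial.eval_pow, Polynomial.eval_X] at hx
  linear_combination hx

lemma exists_odd_factorization {n k l : ℕ} (hn : 0 < n) (hk : 0 < k) (hlk : l ∣ k)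
    (hkl : Odd (k / l)) (hnd : Even (n / n.gcd k)) :
    ∃ a m q, l = n.gcd l * a ∧ n.gcd k = n.gcd l * m ∧ k / Nat.lcm (n.gcd k) l = q ∧
      k = n.gcd l * a * m * q ∧ a.Coprime m ∧ Odd a ∧ Odd m ∧ Odd q := by
  have hl : 0 < l := Nat.pos_of_dvd_of_pos hlk hk
  have hd : 0 < n.gcd k := Nat.gcd_pos_of_pos_left _ hn
  have hgcd : (n.gcd k).gcd l = n.gcd l := by
    rw [Nat.gcd_assoc, Nat.gcd_eq_right hlk]
  have he : 0 < n.gcd l := Nat.gcd_pos_of_pos_left _ hn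
  obtain ⟨m, hm⟩ : n.gcd l ∣ n.gcd k := hgcd ▸ Nat.gcd_dvd_left _ _
  obtain ⟨a, ha⟩ : n.gcd l ∣ l := Nat.gcd_dvd_right _ _
  obtain ⟨q, hq⟩ : Nat.lcm (n.gcd k) l ∣ k := Nat.lcm_dvd (Nat.gcd_dvd_right _ _) hlk
  have hlcm : Nat.lcm (n.gcd k) l = n.gcd l * a * m := by
    have h := Nat.gcd_mul_lcm (n.gcd k) l
    rw [hgcd] at h
    apply Nat.eq_of_mul_eq_mul_left he
    rw [h]
    rw [hm, ← ha, mul_assoc, mul_comm m]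
  have hcop : a.Coprime m := by
    have : n.gcd l * (m.gcd a) = n.gcd l * 1 := by
      rw [← Nat.gcd_mul_left, ← hm, ← ha, hgcd, mul_one]
    rw [Nat.coprime_comm]
    exact Nat.eq_of_mul_eq_mul_left he this
  have hk' : k = n.gcd l * a * m * q := by rw [← hlcm]; exact hq
  have hL : 0 < Nat.lcm (n.gcd k) l := Nat.lcm_pos hd hl
  have hdiv : k / l = m * q := by
    apply Nat.div_eq_of_eq_mul_right hl
    rw [← ha] at hk'
    rw [← mul_assoc]; exact hk'
  have hkd : k / n.gcd k = a * q := by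
    apply Nat.div_eq_of_eq_mul_right hd
    rw [hm]; refine hk'.trans ?_; ring
  have hodd : Odd (a * q) := by
    rw [← hkd, ← Nat.not_even_iff_odd]
    intro h
    have := Nat.dvd_gcd hnd.two_dvd h.two_dvd
    rw [Nat.coprime_div_gcd_div_gcd hd] at this
    omega
  rw [hdiv] at hkl
  refine ⟨a, m, q, ha, hm, ?_, hk', hcop, ?_, ?_, ?_⟩
  · exact Nat.div_eq_of_eq_mul_right hL hq
  · exact (Nat.odd_mul.1 hodd).1
  · exact (Nat.odd_mul.1 hkl).1
  · exact (Nat.odd_mul.1 hodd).2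

lemma pow_gcd_apply_eq_neg {A : Type*} [AddCommGroup A] (F : Module.End ℤ A) {x : A} {n k : ℕ}
    (hn : (F ^ n) x = x) (hk : (F ^ k) x = -x) (hodd : Odd (k / n.gcd k)) :
    (F ^ n.gcd k) x = -x := by
  have hfix : (F ^ (2 * n.gcd k)) x = x := by
    have hn' : Function.IsPeriodicPt F n x := by
      rw [Function.IsPeriodicPt, Function.IsFixedPt, ← Module.End.coe_pow, hn]
    have hk' : Function.IsPeriodicPt F (2 * k) x := by
      rw [Function.IsPeriodicPt, Function.IsFixedPt, ← Module.End.coe_pow, two_mul, pow_add,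
        Module.End.mul_apply, hk, map_neg, hk, neg_neg]
    have hdvd : n.gcd (2 * k) ∣ 2 * n.gcd k := by
      rw [← Nat.gcd_mul_left]
      exact Nat.gcd_dvd_gcd_of_dvd_left _ (Dvd.intro_left _ rfl)
    have := (hn'.gcd hk').trans_dvd hdvd
    rwa [Function.IsPeriodicPt, Function.IsFixedPt, ← Module.End.coe_pow] at this
  obtain ⟨j, hj⟩ := hodd
  have hkj : k = n.gcd k + 2 * n.gcd k * j := by
    conv_lhs => rw [← Nat.mul_div_cancel' (Nat.gcd_dvd_right n k), hj]
    ring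
  rw [← hk]
  conv_rhs => rw [hkj, pow_add, Module.End.mul_apply, pow_mul_apply_of_fixed F hfix]

/-- The alternating sum `Smap p u v` divides `1 + F^v` when `v / u` is odd. -/
lemma Smap_add_pow (p : ℕ) [Fact p.Prime] {u v : ℕ} (huv : u ∣ v) (hodd : Odd (v / u))
    (x : AlgebraicClosure (ZMod p)) :
    Smap p u v x + Smap p u v x ^ p ^ u = x + x ^ p ^ v := by
  have h := mul_neg_geom_sum (-frobEnd p ^ u) (v / u)
  rw [hodd.neg_pow, ← pow_mul, Nat.mul_div_cancel' huv, sub_neg_eq_add, sub_neg_eq_add] at h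
  have h' := DFunLike.congr_fun h x
  have hS : (∑ i ∈ range (v / u), (-frobEnd p ^ u) ^ i) x = Smap p u v x := by
    rw [Smap_eq_sum]
    exact LinearMap.sum_apply _ _ _
  rw [Module.End.mul_apply, hS] at h'
  simpa [frobEnd_pow_apply] using h'

/-- On the kernel of `1 + F^d`, the map `Smap p l k` is `k / lcm d l` times `Smap p e d`, where
`d = e * m`, `l = e * a` and `k = e * a * m * q`. -/
lemma Smap_eq_nsmul (p : ℕ) [Fact p.Prime] {e a m q : ℕ} (he : 0 < e) (ham : a.Coprime m)
    (ha : Odd a) (hm : Odd m) {x : AlgebraicClosure (ZMod p)} (hx : x ^ p ^ (e * m) = -x) :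
    Smap p (e * a) (e * a * m * q) x = q • Smap p e (e * m) x := by
  have hG : ((-frobEnd p ^ e) ^ m) x = x := by
    rw [hm.neg_pow, ← pow_mul]
    simp [frobEnd_pow_apply, hx]
  have hGa : (((-frobEnd p ^ e) ^ a) ^ m) x = x := by
    rw [← pow_mul, mul_comm a m]
    exact pow_mul_apply_of_fixed _ hG a
  rw [Smap_eq_sum, Smap_eq_sum, mul_assoc (e * a), Nat.mul_div_cancel_left _ (by
    have := ha.pos; positivity), Nat.mul_div_cancel_left _ he, pow_mul, ← ha.neg_pow,
    sum_range_mul_pow_apply_of_fixed _ hGa, sum_pow_pow_apply_of_coprime _ hm.pos hG ham]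

/-- The kernel of `Smap p l k` in `𝔽_{p^n}`, described inside the kernel of `1 + F^{gcd(n,k)}`. -/
lemma mem_Ffield_and_Smap_eq_zero_iff (p : ℕ) [Fact p.Prime] {n k l : ℕ} (hn : 0 < n) (hk : 0 < k)
    (hlk : l ∣ k) (hkl : Odd (k / l)) (hnd : Even (n / n.gcd k))
    (x : AlgebraicClosure (ZMod p)) :
    (x ∈ Ffield p n ∧ Smap p l k x = 0) ↔ x + x ^ p ^ n.gcd k = 0 ∧
      (k / Nat.lcm (n.gcd k) l) • Smap p (n.gcd l) (n.gcd k) x = 0 := by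
  obtain ⟨a, m, q, hl, hd, hq, hk', ham, ha, hm, hqo⟩ :=
    exists_odd_factorization hn hk hlk hkl hnd
  have he : 0 < n.gcd l := Nat.gcd_pos_of_pos_left _ hn
  have hS : x + x ^ p ^ n.gcd k = 0 →
      Smap p l k x = (k / Nat.lcm (n.gcd k) l) • Smap p (n.gcd l) (n.gcd k) x := by
    intro h
    have := Smap_eq_nsmul p (q := q) he ham ha hm (x := x) (by
      rw [← hd]; exact eq_neg_of_add_eq_zero_right h)
    rwa [← hk', ← hl, ← hd, ← hq] at this
  constructor
  · rintro ⟨hxn, hxS⟩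
    have hxd : x + x ^ p ^ n.gcd k = 0 := by
      rw [← frobEnd_pow_apply, pow_gcd_apply_eq_neg, add_neg_cancel]
      · rw [frobEnd_pow_apply]; exact hxn
      · have := Smap_add_pow p hlk hkl x
        rw [hxS, zero_pow (pow_ne_zero _ (Fact.out : p.Prime).ne_zero), add_zero] at this
        rw [frobEnd_pow_apply]
        exact eq_neg_of_add_eq_zero_right this.symm
      · have hkd : k / n.gcd k = a * q := by
          apply Nat.div_eq_of_eq_mul_right (Nat.gcd_pos_of_pos_left _ hn)
          rw [hd]; refine hk'.trans ?_; ring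
        rw [hkd]; exact ha.mul hqo
    exact ⟨hxd, hS hxd ▸ hxS⟩
  · rintro ⟨hxd, hx0⟩
    refine ⟨?_, (hS hxd).trans hx0⟩
    obtain ⟨j, hj⟩ := hnd.two_dvd
    have hnj : n = n.gcd k * 2 * j := by
      conv_lhs => rw [← Nat.mul_div_cancel' (Nat.gcd_dvd_left n k), hj, ← mul_assoc]
    have hfix : (frobEnd p ^ (n.gcd k * 2)) x = x := by
      have hneg := eq_neg_of_add_eq_zero_right hxd
      rw [← frobEnd_pow_apply] at hneg
      rw [mul_two, pow_add, Module.End.mul_apply, hneg, map_neg, hneg, neg_neg]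
    change x ^ p ^ n = x
    rw [← frobEnd_pow_apply, hnj]
    exact pow_mul_apply_of_fixed _ hfix j

lemma setOf_add_pow_eq_zero_eq_image (p : ℕ) [Fact p.Prime] {d : ℕ} (hd : 0 < d) :
    {x : AlgebraicClosure (ZMod p) | x + x ^ p ^ d = 0} =
      (fun x => x - x ^ p ^ d) '' Ffield p (2 * d) := by
  have hp := (Fact.out : p.Prime).one_lt
  have key : ∀ y : AlgebraicClosure (ZMod p),
      (y - y ^ p ^ d) + (y - y ^ p ^ d) ^ p ^ d = y - y ^ p ^ (2 * d) := by
    intro y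
    rw [sub_pow_char_pow, two_mul, pow_add p, pow_mul]
    ring
  ext x
  constructor
  · intro hx
    obtain ⟨y, hy⟩ := exists_add_mul_pow_eq hp hd (neg_ne_zero.2 one_ne_zero) x
    have hy' : y - y ^ p ^ d = x := by rw [← hy]; ring
    refine ⟨y, ?_, hy'⟩
    have := key y
    rw [hy'] at this
    exact (sub_eq_zero.1 (this.symm.trans hx)).symm
  · rintro ⟨y, hy, rfl⟩
    exact (key y).trans (sub_eq_zero.2 (Eq.symm hy))

lemma Smap_add_pow_self (p : ℕ) [Fact p.Prime] {u v : ℕ} (huv : u ∣ v) (hodd : Odd (v / u))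
    (x : AlgebraicClosure (ZMod p)) : Smap p u v (x + x ^ p ^ u) = x + x ^ p ^ v := by
  rw [← Smap_add_pow p huv hodd]
  simp only [Smap]
  rw [sum_pow_char_pow, ← sum_add_distrib]
  refine sum_congr rfl fun i _ => ?_
  have hneg : ((-1 : AlgebraicClosure (ZMod p)) ^ i) ^ p ^ u = (-1) ^ i := by
    rw [← pow_mul, mul_comm, pow_mul, neg_one_pow_char_pow]
  rw [add_pow_char_pow, mul_pow, hneg, mul_add, ← pow_mul, ← pow_mul, mul_comm (p ^ u)]

lemma setOf_Smap_eq_zero_eq_image (p : ℕ) [Fact p.Prime] {e d : ℕ} (he : 0 < e) (hd : 0 < d)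
    (hed : e ∣ d) (hodd : Odd (d / e)) :
    {x : AlgebraicClosure (ZMod p) | Smap p e d x = 0} =
      (fun x => (x + x ^ p ^ e) - (x + x ^ p ^ e) ^ p ^ d) '' Ffield p (2 * d) := by
  have hp := (Fact.out : p.Prime).one_lt
  have key : ∀ y : AlgebraicClosure (ZMod p),
      Smap p e d ((y + y ^ p ^ e) - (y + y ^ p ^ e) ^ p ^ d) = y - y ^ p ^ (2 * d) := by
    intro y
    have : (y + y ^ p ^ e) - (y + y ^ p ^ e) ^ p ^ d =
        (y - y ^ p ^ d) + (y - y ^ p ^ d) ^ p ^ e := by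
      rw [sub_pow_char_pow, add_pow_char_pow, ← pow_mul, ← pow_mul, mul_comm (p ^ d)]
      ring
    rw [this, Smap_add_pow_self p hed hodd, sub_pow_char_pow, two_mul, pow_add p, pow_mul]
    ring
  ext x
  constructor
  · intro hx
    obtain ⟨z, hz⟩ := exists_add_mul_pow_eq hp hd (neg_ne_zero.2 one_ne_zero) x
    obtain ⟨y, hy⟩ := exists_add_mul_pow_eq hp he one_ne_zero z
    rw [one_mul] at hy
    have hy' : (y + y ^ p ^ e) - (y + y ^ p ^ e) ^ p ^ d = x := by rw [hy, ← hz]; ring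
    refine ⟨y, ?_, hy'⟩
    have := key y
    rw [hy'] at this
    exact (sub_eq_zero.1 (this.symm.trans hx)).symm
  · rintro ⟨y, hy, rfl⟩
    exact (key y).trans (sub_eq_zero.2 (Eq.symm hy))

lemma ncard_setOf_add_pow_eq_zero (p : ℕ) [Fact p.Prime] {d : ℕ} (hd : 0 < d) :
    {x : AlgebraicClosure (ZMod p) | x + x ^ p ^ d = 0}.ncard = p ^ d := by
  have := ncard_linearized_roots (K := AlgebraicClosure (ZMod p)) (p := p) (r := d) (m := 1)
    (c := fun _ => 1) (Fact.out : p.Prime).one_lt hd one_ne_zero one_ne_zero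
  simpa [sum_range_succ] using this

lemma ncard_setOf_Smap_eq_zero (p : ℕ) [Fact p.Prime] {e d : ℕ} (he : 0 < e) (hd : 0 < d)
    (hed : e ∣ d) :
    {x : AlgebraicClosure (ZMod p) | Smap p e d x = 0}.ncard = p ^ (d - e) := by
  obtain ⟨m, rfl⟩ := hed
  obtain ⟨m, rfl⟩ := Nat.exists_eq_succ_of_ne_zero (Nat.pos_of_mul_pos_left hd).ne'
  have := ncard_linearized_roots (K := AlgebraicClosure (ZMod p)) (p := p) (r := e) (m := m)
    (c := fun i => (-1) ^ i) (Fact.out : p.Prime).one_lt he (by simp) (by simp)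
  simp only [Smap, Nat.mul_div_cancel_left _ he]
  rw [Nat.mul_succ, Nat.add_sub_cancel]
  exact this

theorem stmt12 (p : ℕ) [Fact p.Prime] (n k l : ℕ) (hn : 0 < n) (hk : 0 < k) (hl : 0 < l)
    (hlk : l ∣ k) (hkl : Odd (k / l)) (d e L : ℕ)
    (hd : d = Nat.gcd n k) (he : e = Nat.gcd n l) (hL : L = Nat.lcm d l)
    (hnd : Even (n / d)) :
    (p ∣ k / L →
      {x | x ∈ Ffield p n ∧ Smap p l k x = 0} =
        (fun x => x - x ^ p ^ d) '' Ffield p (2 * d) ∧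
      {x | x ∈ Ffield p n ∧ Smap p l k x = 0}.ncard = p ^ d) ∧
    (¬ p ∣ k / L →
      {x | x ∈ Ffield p n ∧ Smap p l k x = 0} =
        (fun x => (x + x ^ p ^ e) - (x + x ^ p ^ e) ^ p ^ d) '' Ffield p (2 * d) ∧
      {x | x ∈ Ffield p n ∧ Smap p l k x = 0}.ncard = p ^ (d - e)) := by
  subst hd he hL
  have hd : 0 < n.gcd k := Nat.gcd_pos_of_pos_left _ hn
  have he : 0 < n.gcd l := Nat.gcd_pos_of_pos_left _ hn
  have hed : n.gcd l ∣ n.gcd k := Nat.gcd_dvd_gcd_of_dvd_right _ hlk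
  have hodd : Odd (n.gcd k / n.gcd l) := by
    obtain ⟨a, m, q, -, hm, -, -, -, -, hmo, -⟩ :=
      exists_odd_factorization hn hk hlk hkl hnd
    rwa [Nat.div_eq_of_eq_mul_right he hm]
  simp only [mem_Ffield_and_Smap_eq_zero_iff p hn hk hlk hkl hnd, nsmul_eq_mul, mul_eq_zero,
    CharP.cast_eq_zero_iff (AlgebraicClosure (ZMod p)) p]
  constructor
  · intro h
    simp only [h, true_or, and_true]
    exact ⟨setOf_add_pow_eq_zero_eq_image p hd, ncard_setOf_add_pow_eq_zero p hd⟩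
  · intro h
    have hset : {x : AlgebraicClosure (ZMod p) | x + x ^ p ^ n.gcd k = 0 ∧
        (p ∣ k / Nat.lcm (n.gcd k) l ∨ Smap p (n.gcd l) (n.gcd k) x = 0)} =
        {x | Smap p (n.gcd l) (n.gcd k) x = 0} := by
      ext x
      simp only [h, false_or, Set.mem_ofPred_eq, and_iff_right_iff_imp]
      intro hx
      rw [← Smap_add_pow p hed hodd, hx, zero_pow (pow_ne_zero _ (Fact.out : p.Prime).ne_zero),
        add_zero]
    rw [hset]
    exact ⟨setOf_Smap_eq_zero_eq_image p he hd hed hodd, ncard_setOf_Smap_eq_zero p he hd hed⟩
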